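/- arXiv:1906.09501 — 2 statements merged into one kernel-verified Lean document; each statement's English description precedes it below -/
import Mathlib

section
/- Let Σ be an n×n real symmetric positive definite matrix with inverse K = Σ⁻¹, and suppose the index set [n] is partitioned into disjoint sets C, S, B such that K_{c,b} = 0 for all c ∈ C and b ∈ B (equivalently, S separates C from B in the concentration graph of Σ). Then K_{C,C} = (Σ_{C|S})⁻¹, where Σ_{C|S} := Σ_{C,C} − Σ_{C,S} (Σ_{S,S})⁻¹ Σ_{S,C}. -/
/-- The submatrix of `M` with rows indexed by `A` and columns indexed by `B`. -/
def subm {n : ℕ} (M : Matrix (Fin n) (Fin n) ℝ) (A B : Finset (Fin n)) :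
    Matrix A B ℝ :=
  M.submatrix (fun a : A => (a : Fin n)) (fun b : B => (b : Fin n))

/-- A product of matrices splits as a sum of block products when the columns of the left factor
outside `C ∪ S` vanish on the rows considered. -/
theorem subm_mul_of_eq_zero {n : ℕ} (M N : Matrix (Fin n) (Fin n) ℝ)
    (A X C S B : Finset (Fin n))
    (hCS : Disjoint C S) (hCB : Disjoint C B) (hSB : Disjoint S B)
    (hcover : C ∪ S ∪ B = Finset.univ)
    (hzero : ∀ a ∈ A, ∀ b ∈ B, M a b = 0) :
    subm (M * N) A X = subm M A C * subm N C X + subm M A S * subm N S X := by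
  ext a x
  simp only [subm, Matrix.submatrix_apply, Matrix.mul_apply, Matrix.add_apply]
  rw [← hcover, Finset.sum_union (Finset.disjoint_union_left.2 ⟨hCB, hSB⟩),
    Finset.sum_union hCS,
    Finset.sum_eq_zero (s := B) fun b hb => by rw [hzero a a.2 b hb, zero_mul], add_zero,
    ← Finset.sum_coe_sort C, ← Finset.sum_coe_sort S]

theorem subm_one_self {n : ℕ} (A : Finset (Fin n)) : subm 1 A A = 1 :=
  Matrix.submatrix_one _ Subtype.val_injective

theorem subm_one_of_disjoint {n : ℕ} {A B : Finset (Fin n)} (h : Disjoint A B) :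
    subm 1 A B = 0 := by
  ext a b
  exact Matrix.one_apply_ne (Finset.disjoint_iff_ne.1 h a a.2 b b.2)

/-- Let `Cov` be symmetric positive definite with inverse `K`, and let
`[n]` be partitioned into disjoint sets `C`, `S`, `B` with `K_{c,b} = 0` for all `c ∈ C`,
`b ∈ B`. Then `K_{C,C} = (Σ_{C|S})⁻¹` where
`Σ_{C|S} = Σ_{C,C} − Σ_{C,S} (Σ_{S,S})⁻¹ Σ_{S,C}`. -/
theorem inv_conditional_cov {n : ℕ} (Cov : Matrix (Fin n) (Fin n) ℝ)
    (hpd : Cov.PosDef) (hsymm : Cov.IsSymm)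
    (K : Matrix (Fin n) (Fin n) ℝ) (hK : K = Cov⁻¹)
    (C S B : Finset (Fin n))
    (hCS : Disjoint C S) (hCB : Disjoint C B) (hSB : Disjoint S B)
    (hcover : C ∪ S ∪ B = Finset.univ)
    (hzero : ∀ c ∈ C, ∀ b ∈ B, K c b = 0) :
    subm K C C = (subm Cov C C - subm Cov C S * (subm Cov S S)⁻¹ * subm Cov S C)⁻¹ := by
  have hmul : K * Cov = 1 := by
    rw [hK]
    exact Matrix.nonsing_inv_mul _ ((Matrix.isUnit_iff_isUnit_det _).1 hpd.isUnit)
  have hS : IsUnit (subm Cov S S).det :=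
    (Matrix.isUnit_iff_isUnit_det _).1 (hpd.submatrix Subtype.val_injective).isUnit
  have hCC := subm_mul_of_eq_zero K Cov C C C S B hCS hCB hSB hcover hzero
  have hCS' := subm_mul_of_eq_zero K Cov C S C S B hCS hCB hSB hcover hzero
  rw [hmul, subm_one_self] at hCC
  rw [hmul, subm_one_of_disjoint hCS] at hCS'
  have hKCS : subm K C C * subm Cov C S * (subm Cov S S)⁻¹ = -subm K C S := by
    rw [eq_neg_of_add_eq_zero_left hCS'.symm, Matrix.neg_mul,
      Matrix.mul_nonsing_inv_cancel_right _ _ hS]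
  refine (Matrix.inv_eq_left_inv ?_).symm
  rw [Matrix.mul_sub, ← Matrix.mul_assoc, ← Matrix.mul_assoc, hKCS, Matrix.neg_mul,
    sub_neg_eq_add, ← hCC]
end

section
/- Let Σ be an n×n real symmetric positive definite matrix with inverse K = Σ⁻¹. Suppose [n] is partitioned into disjoint sets B, S, S', C_1, …, C_d such that, writing C = S' ∪ C_1 ∪ … ∪ C_d, K_{c,b} = 0 for all c ∈ C, b ∈ B, and K_{C_i, C_j} = 0 for all i ≠ j. Then for every i, K_{C_i, S'} = − K_{C_i, C_i} Σ_{C_i, S'|S} (Σ_{S'|S})⁻¹, and K_{S', S'} = ( I − Σ_{i=1}^{d} K_{S', C_i} Σ_{C_i, S'|S} ) (Σ_{S'|S})⁻¹, where I is the |S'|×|S'| identity matrix. -/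
/-- The conditional covariance `Σ_{A,B|S} = Σ_{A,B} − Σ_{A,S} (Σ_{S,S})⁻¹ Σ_{S,B}`. -/
noncomputable def condCov {n : ℕ} (M : Matrix (Fin n) (Fin n) ℝ)
    (A B S : Finset (Fin n)) : Matrix A B ℝ :=
  subm M A B - subm M A S * (subm M S S)⁻¹ * subm M S B

/-- A Schur complement in a positive definite matrix is invertible. -/
theorem isUnit_condCov {n : ℕ} {M : Matrix (Fin n) (Fin n) ℝ} (hM : M.PosDef)
    {A S : Finset (Fin n)} (hSA : Disjoint S A) : IsUnit (condCov M A A S) := by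
  have hS : IsUnit (subm M S S) := (hM.submatrix Subtype.val_injective).isUnit
  let := hS.invertible
  have hinj : Function.Injective
      (Sum.elim (fun a : S => (a : Fin n)) (fun a : A => (a : Fin n))) :=
    Subtype.val_injective.sumElim Subtype.val_injective
      fun a b h => Finset.disjoint_left.1 hSA a.2 (h ▸ b.2)
  have hblocks : M.submatrix (Sum.elim (fun a : S => (a : Fin n)) (fun a : A => (a : Fin n)))
      (Sum.elim (fun a : S => (a : Fin n)) (fun a : A => (a : Fin n))) =
      Matrix.fromBlocks (subm M S S) (subm M S A) (subm M A S) (subm M A A) := by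
    ext (i | i) (j | j) <;> rfl
  have hunit := (hM.submatrix hinj).isUnit
  rw [hblocks, Matrix.isUnit_fromBlocks_iff_of_invertible₁₁, Matrix.invOf_eq_nonsing_inv] at hunit
  exact hunit

/-- Rows of a left inverse outside `S`, applied to the conditional covariance columns,
give rows of the identity. -/
theorem sum_mul_condCov {n : ℕ} {M K : Matrix (Fin n) (Fin n) ℝ} (hKM : K * M = 1)
    (A S : Finset (Fin n)) {c : Fin n} (hc : c ∉ S) (s : A) :
    ∑ v, K c v * condCov M Finset.univ A S ⟨v, Finset.mem_univ v⟩ s =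
      (1 : Matrix (Fin n) (Fin n) ℝ) c s := by
  have hcol (b : Fin n) : ∑ v, K c v * M v b = (1 : Matrix (Fin n) (Fin n) ℝ) c b := by
    rw [← hKM, Matrix.mul_apply]
  have hzero : ∑ v, K c v * (subm M Finset.univ S * ((subm M S S)⁻¹ * subm M S A))
      ⟨v, Finset.mem_univ v⟩ s = 0 := by
    simp only [Matrix.mul_apply (M := subm M Finset.univ S), Finset.mul_sum, ← mul_assoc]
    rw [Finset.sum_comm]
    refine Finset.sum_eq_zero fun u _ => ?_
    rw [← Finset.sum_mul]
    have hne : c ≠ u := fun h => hc (h ▸ u.2)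
    have := hcol u
    rw [Matrix.one_apply_ne hne] at this
    simp [subm, this]
  simp only [condCov, Matrix.mul_assoc, Matrix.sub_apply, mul_sub, Finset.sum_sub_distrib, hzero,
    sub_zero]
  exact hcol s

/-- The rows of the conditional covariance indexed by the conditioning set vanish. -/
theorem condCov_apply_of_mem {n : ℕ} {M : Matrix (Fin n) (Fin n) ℝ} (hM : M.PosDef)
    (A S : Finset (Fin n)) {v : Fin n} (hv : v ∈ S) (s : A) :
    condCov M Finset.univ A S ⟨v, Finset.mem_univ v⟩ s = 0 := by
  have hS : IsUnit (subm M S S) := (hM.submatrix Subtype.val_injective).isUnit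
  have h : condCov M S A S = 0 := by
    rw [condCov, Matrix.mul_nonsing_inv _ ((Matrix.isUnit_iff_isUnit_det _).1 hS), Matrix.one_mul,
      sub_self]
  exact congrFun (congrFun h ⟨v, hv⟩) s


/-- Let `Cov` be symmetric positive definite with inverse `K` and let
`[n]` be partitioned into disjoint sets `B`, `S`, `S'`, `C 0, …, C (d-1)` such that,
with `C' = S' ∪ ⋃ᵢ C i`, `K_{c,b} = 0` for `c ∈ C'`, `b ∈ B`, and `K_{C i, C j} = 0` for
`i ≠ j`. Then `K_{C i,S'} = −K_{C i,C i} Σ_{C i,S'|S} (Σ_{S'|S})⁻¹` for every `i`, and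
`K_{S',S'} = (I − Σᵢ K_{S',C i} Σ_{C i,S'|S}) (Σ_{S'|S})⁻¹`. -/
theorem K_blocks_formula {n d : ℕ} (Cov : Matrix (Fin n) (Fin n) ℝ)
    (hpd : Cov.PosDef) (hsymm : Cov.IsSymm)
    (K : Matrix (Fin n) (Fin n) ℝ) (hK : K = Cov⁻¹)
    (B S S' : Finset (Fin n)) (C : Fin d → Finset (Fin n))
    (hBS : Disjoint B S) (hBS' : Disjoint B S') (hSS' : Disjoint S S')
    (hBC : ∀ i, Disjoint B (C i)) (hSC : ∀ i, Disjoint S (C i))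
    (hS'C : ∀ i, Disjoint S' (C i))
    (hCC : ∀ i j : Fin d, i ≠ j → Disjoint (C i) (C j))
    (hcover : B ∪ S ∪ S' ∪ Finset.univ.biUnion C = Finset.univ)
    (hzeroB : ∀ c : Fin n, (c ∈ S' ∨ ∃ i, c ∈ C i) → ∀ b ∈ B, K c b = 0)
    (hzeroCC : ∀ i j : Fin d, i ≠ j → ∀ u ∈ C i, ∀ v ∈ C j, K u v = 0) :
    (∀ i : Fin d,
      subm K (C i) S' = -(subm K (C i) (C i) * condCov Cov (C i) S' S * (condCov Cov S' S' S)⁻¹)) ∧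
      subm K S' S' =
        ((1 : Matrix S' S' ℝ) - ∑ i : Fin d, subm K S' (C i) * condCov Cov (C i) S' S) *
          (condCov Cov S' S' S)⁻¹ := by
  have hKM : K * Cov = 1 := by
    rw [hK, Matrix.nonsing_inv_mul _ ((Matrix.isUnit_iff_isUnit_det _).1 hpd.isUnit)]
  have hdet := (Matrix.isUnit_iff_isUnit_det _).1 (isUnit_condCov hpd hSS')
  have hsplit (c : Fin n) (hc : c ∈ S' ∨ ∃ i, c ∈ C i) (s : S') :
      ∑ v : S', K c v * condCov Cov S' S' S v s +
        ∑ i, ∑ v : C i, K c v * condCov Cov (C i) S' S v s =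
        (1 : Matrix (Fin n) (Fin n) ℝ) c s := by
    have hcS : c ∉ S := by
      rcases hc with h | ⟨i, h⟩
      · exact Finset.disjoint_right.1 hSS' h
      · exact Finset.disjoint_right.1 (hSC i) h
    let f (v : Fin n) : ℝ := K c v * condCov Cov Finset.univ S' S ⟨v, Finset.mem_univ v⟩ s
    have hB : ∑ v ∈ B, f v = 0 :=
      Finset.sum_eq_zero fun b hb => by simp [f, hzeroB c hc b hb]
    have hS : ∑ v ∈ S, f v = 0 :=
      Finset.sum_eq_zero fun v hv => by simp [f, condCov_apply_of_mem hpd S' S hv]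
    have hS' : ∑ v : S', K c v * condCov Cov S' S' S v s = ∑ v ∈ S', f v :=
      Finset.sum_coe_sort S' f
    have hC (i : Fin d) : ∑ v : C i, K c v * condCov Cov (C i) S' S v s = ∑ v ∈ C i, f v :=
      Finset.sum_coe_sort (C i) f
    have huniv : ∑ v, f v = (1 : Matrix (Fin n) (Fin n) ℝ) c s := sum_mul_condCov hKM S' S hcS s
    rw [← huniv, ← hcover, Finset.sum_union, Finset.sum_union,
      Finset.sum_union hBS, Finset.sum_biUnion fun i _ j _ hij => hCC i j hij,
      hB, hS, zero_add, zero_add, hS', Finset.sum_congr rfl fun i _ => hC i]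
    · exact Finset.disjoint_union_left.2 ⟨hBS', hSS'⟩
    · simp only [Finset.disjoint_union_left, Finset.disjoint_biUnion_right]
      exact fun i _ => ⟨⟨hBC i, hSC i⟩, hS'C i⟩
  refine ⟨fun i => ?_, ?_⟩
  · have h : subm K (C i) S' * condCov Cov S' S' S =
        -(subm K (C i) (C i) * condCov Cov (C i) S' S) := by
      ext c s
      have hcs := hsplit c (Or.inr ⟨i, c.2⟩) s
      rw [Finset.sum_eq_single i, Matrix.one_apply_ne] at hcs
      · exact eq_neg_of_add_eq_zero_left hcs
      · exact fun h => Finset.disjoint_right.1 (hS'C i) c.2 (h ▸ s.2)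
      · exact fun j _ hj => Finset.sum_eq_zero fun v _ => by
          rw [hzeroCC i j hj.symm c c.2 v v.2, zero_mul]
      · simp
    rw [← Matrix.neg_mul, ← h, Matrix.mul_nonsing_inv_cancel_right _ _ hdet]
  · have h : subm K S' S' * condCov Cov S' S' S =
        1 - ∑ i, subm K S' (C i) * condCov Cov (C i) S' S := by
      refine eq_sub_of_add_eq ?_
      ext c s
      rw [Matrix.add_apply, Matrix.sum_apply]
      refine (hsplit c (Or.inl c.2) s).trans ?_
      rw [Matrix.one_apply, Matrix.one_apply]
      exact if_congr Subtype.ext_iff.symm rfl rfl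
    rw [← h, Matrix.mul_nonsing_inv_cancel_right _ _ hdet]
end
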